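/- Let m ≥ 1, let α be a primitive element of 𝔽_{2^m}, let t be a positive divisor of 2^m − 1, and set l = (2^m − 1)/t. Suppose S = Σ_{μ=1}^{l−1} (α^{μt} + 1)^{−1} = 1 in 𝔽_{2^m}. Let L = {a ∈ 𝔽_{2^m} : a^t ≠ 1} (so |L| = 2^m − t, and 0 ∈ L). Then Σ_{a ∈ L} (z − a)^{−1} = 0 in the quotient ring 𝔽_{2^m}[z]/(z^t + 1); equivalently, the all-ones vector of length 2^m − t is a codeword of the binary Goppa code Γ(L, z^t + 1). -/

import Mathlib

open Polynomial

/-- In an algebra containing a root `x` of `z ^ t + 1`, the element `x - a` is inverted by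
an explicit polynomial in `x` as soon as `a ^ t + 1 ≠ 0`. -/
theorem inverse_sub_algebraMap_of_pow_eq_neg_one {K A : Type*} [Field K] [CommRing A]
    [Algebra K A] {t : ℕ} {x : A} (hx : x ^ t = -1) {a : K} (ha : a ^ t + 1 ≠ 0) :
    Ring.inverse (x - algebraMap K A a) =
      -∑ i ∈ Finset.range t, x ^ i * algebraMap K A (a ^ (t - 1 - i) * (a ^ t + 1)⁻¹) := by
  have h : (x - algebraMap K A a) *
      (-∑ i ∈ Finset.range t, x ^ i * algebraMap K A (a ^ (t - 1 - i) * (a ^ t + 1)⁻¹)) = 1 := by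
    have hg := (Commute.all x (algebraMap K A a)).mul_geom_sum₂ t
    have hinv : algebraMap K A (a ^ t + 1) * algebraMap K A (a ^ t + 1)⁻¹ = 1 := by
      rw [← map_mul, mul_inv_cancel₀ ha, map_one]
    simp only [map_mul, map_pow, ← mul_assoc, ← Finset.sum_mul]
    rw [mul_neg, ← mul_assoc, hg, hx]
    rw [map_add, map_pow, map_one] at hinv
    linear_combination hinv
  have hu : IsUnit (x - algebraMap K A a) := .of_mul_eq_one _ h
  rw [← mul_one (Ring.inverse _), ← h, Ring.inverse_mul_cancel_left _ _ hu]

/-- A generator of the nonzero elements of a finite field is a primitive root of unity. -/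
theorem isPrimitiveRoot_card_sub_one_of_forall_eq_pow {F : Type*} [Field F] [Fintype F]
    {α : F} (hα0 : α ≠ 0) (hα : ∀ x : F, x ≠ 0 → ∃ k : ℕ, x = α ^ k) :
    IsPrimitiveRoot α (Fintype.card F - 1) := by
  classical
  have h : orderOf (Units.mk0 α hα0) = Fintype.card F - 1 := by
    rw [orderOf_eq_card_of_forall_mem_powers, Nat.card_eq_fintype_card, Fintype.card_units]
    intro x
    obtain ⟨k, hk⟩ := hα x x.ne_zero
    exact ⟨k, Units.ext (by simp [hk])⟩
  rw [← h]
  exact IsPrimitiveRoot.coe_units_iff.2 (IsPrimitiveRoot.orderOf (Units.mk0 α hα0))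

/-- Summing over a finite field amounts to summing over `0` and the powers of a generator. -/
theorem IsPrimitiveRoot.sum_univ_eq {F M : Type*} [Field F] [Fintype F] [AddCommMonoid M]
    {α : F} (hα : IsPrimitiveRoot α (Fintype.card F - 1)) (f : F → M) :
    ∑ a, f a = f 0 + ∑ k ∈ Finset.range (Fintype.card F - 1), f (α ^ k) := by
  classical
  have hn : Fintype.card F - 1 ≠ 0 := by have := Fintype.one_lt_card (α := F); lia
  have hinj : Set.InjOn (α ^ ·) (Finset.range (Fintype.card F - 1) : Set ℕ) := fun i hi j hj h ↦
    hα.pow_inj (by simpa using hi) (by simpa using hj) h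
  have himg : (Finset.range (Fintype.card F - 1)).image (α ^ ·) = Finset.univ.erase 0 := by
    refine Finset.eq_of_subset_of_card_le (fun x hx ↦ ?_) ?_
    · obtain ⟨k, -, rfl⟩ := Finset.mem_image.1 hx
      simp [hα.ne_zero hn]
    · rw [Finset.card_image_of_injOn hinj]
      simp
  rw [← Finset.add_sum_erase _ _ (Finset.mem_univ 0), ← himg, Finset.sum_image hinj]

/-- Sum of an `l`-periodic function over `t` periods. -/
theorem Finset.sum_range_mul_of_periodic {M : Type*} [AddCommMonoid M] {f : ℕ → M} {l : ℕ}
    (hf : f.Periodic l) (t : ℕ) :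
    ∑ k ∈ Finset.range (t * l), f k = t • ∑ k ∈ Finset.range l, f k := by
  induction t with
  | zero => simp
  | succ t ih =>
    rw [add_mul, one_mul, Finset.sum_range_add, ih, succ_nsmul]
    congr 1
    refine Finset.sum_congr rfl fun k _ ↦ ?_
    rw [add_comm]
    exact hf.nat_mul t k

/-- The twisted power sums `∑ a ^ j * g (a ^ t)` over a finite field vanish for `0 < j < t` in the
presence of a primitive `t`-th root of unity. -/
theorem IsPrimitiveRoot.sum_pow_mul_comp_pow_eq_zero {F : Type*} [Field F] [Fintype F]
    {ζ : F} {t j : ℕ} (hζ : IsPrimitiveRoot ζ t) (hj : 0 < j) (hjt : j < t) (g : F → F) :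
    ∑ a, a ^ j * g (a ^ t) = 0 := by
  have hζ0 : ζ ≠ 0 := hζ.ne_zero (by lia)
  have h : ∑ a, a ^ j * g (a ^ t) = ζ ^ j * ∑ a, a ^ j * g (a ^ t) := by
    refine (Equiv.sum_comp (Equiv.mulLeft₀ ζ hζ0) _).symm.trans ?_
    rw [Finset.mul_sum]
    refine Finset.sum_congr rfl fun a _ ↦ ?_
    simp [mul_pow, hζ.pow_eq_one, mul_assoc]
  have h' : (ζ ^ j - 1) * ∑ a, a ^ j * g (a ^ t) = 0 := by linear_combination -h
  exact (mul_eq_zero.1 h').resolve_left (sub_ne_zero.2 (hζ.pow_ne_one_of_pos_of_lt hj.ne' hjt))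

/-- Let `α` be a primitive element of `𝔽_{2^m}`, `t ∣ 2^m - 1` a positive divisor,
`l = (2^m-1)/t`, and suppose `S = ∑_{μ=1}^{l-1} (α^{μt}+1)⁻¹ = 1`.  Let
`L = {a ∈ 𝔽_{2^m} : a^t ≠ 1}` (so `|L| = 2^m - t`).  Then
`∑_{a ∈ L} (z - a)⁻¹ = 0` in `𝔽_{2^m}[z]/(z^t + 1)`; i.e. the all-ones vector is a
codeword of the binary Goppa code `Γ(L, z^t + 1)`. -/
theorem allOnes_mem_goppa_of_S_eq_one
    (m : ℕ) (hm : 1 ≤ m)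
    (F : Type) [Field F] [Fintype F] [DecidableEq F] (hcard : Fintype.card F = 2 ^ m)
    (α : F) (hα : ∀ x : F, x ≠ 0 → ∃ k : ℕ, x = α ^ k)
    (t l : ℕ) (ht : 0 < t) (htdvd : t ∣ 2 ^ m - 1) (hl : l = (2 ^ m - 1) / t)
    (hS : (∑ μ ∈ Finset.Icc 1 (l - 1), (α ^ (μ * t) + 1)⁻¹) = 1) :
    ({a : F | a ^ t ≠ 1} : Set F).ncard = 2 ^ m - t ∧
    ∑ a ∈ Finset.univ.filter (fun a : F => a ^ t ≠ 1),
        Ring.inverse (Ideal.Quotient.mk (Ideal.span {(X ^ t + 1 : F[X])}) (X - C a))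
      = 0 := by
  have : CharP F 2 := charP_of_card_eq_prime_pow hcard
  have hn : t * l = 2 ^ m - 1 := by rw [hl, Nat.mul_div_cancel' htdvd]
  have hpow : 2 ∣ 2 ^ m := dvd_pow_self 2 (by lia)
  have hpos : 2 ≤ 2 ^ m := Nat.le_of_dvd (by positivity) hpow
  have hodd : Odd (t * l) := by rw [Nat.odd_iff]; lia
  obtain ⟨htodd, hlodd⟩ := Nat.odd_mul.1 hodd
  have hα0 : α ≠ 0 := by
    rintro rfl
    have h : ∀ μ ∈ Finset.Icc 1 (l - 1), ((0 : F) ^ (μ * t) + 1)⁻¹ = 1 := fun μ hμ ↦ by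
      have : μ * t ≠ 0 := Nat.mul_ne_zero (by have := (Finset.mem_Icc.1 hμ).1; lia) ht.ne'
      simp [this]
    rw [Finset.sum_congr rfl h] at hS
    have h2 : ((l - 1 : ℕ) : F) = 0 :=
      (CharP.cast_eq_zero_iff F 2 _).2 (by obtain ⟨k, rfl⟩ := hlodd; simp)
    simp [h2] at hS
  have hprim := isPrimitiveRoot_card_sub_one_of_forall_eq_pow hα0 hα
  have hζ : IsPrimitiveRoot (α ^ l) t :=
    hprim.pow (by rw [hcard]; lia) (by rw [hcard, ← hn, mul_comm])
  constructor
  · have h : ({a : F | a ^ t ≠ 1} : Set F) = ((nthRootsFinset t (1 : F) : Finset F) : Set F)ᶜ := by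
      ext a
      simp [mem_nthRootsFinset ht]
    rw [h, ← Finset.coe_compl, Set.ncard_coe_finset, Finset.card_compl, hζ.card_nthRootsFinset,
      hcard]
  have hzero : ∑ a : F, (a ^ t + 1)⁻¹ = 0 := by
    have hper : (fun k ↦ (((α ^ k) ^ t + 1)⁻¹ : F)).Periodic l := fun k ↦ by
      simp [pow_add, mul_pow, hζ.pow_eq_one]
    have hrange : Finset.range l = insert 0 (Finset.Icc 1 (l - 1)) := by
      ext k
      have := hlodd.pos
      simp
      lia
    rw [hprim.sum_univ_eq, hcard, ← hn, Finset.sum_range_mul_of_periodic hper, hrange,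
      Finset.sum_insert (by simp)]
    simp only [← pow_mul, hS]
    have h : ((1 + t : ℕ) : F) = 0 :=
      (CharP.cast_eq_zero_iff F 2 _).2 (by obtain ⟨k, rfl⟩ := htodd; lia)
    simpa [ht.ne', CharTwo.add_self_eq_zero] using h
  have hsum : ∀ j < t, ∑ a : F, a ^ j * (a ^ t + 1)⁻¹ = 0 := fun j hj ↦ by
    obtain rfl | hj0 := Nat.eq_zero_or_pos j
    · simpa using hzero
    · exact hζ.sum_pow_mul_comp_pow_eq_zero hj0 hj fun b ↦ (b + 1)⁻¹
  set I := Ideal.span {(X ^ t + 1 : F[X])}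
  have hx : (Ideal.Quotient.mk I X) ^ t = -1 := by
    rw [eq_neg_iff_add_eq_zero, ← map_pow, ← map_one (Ideal.Quotient.mk I), ← map_add,
      Ideal.Quotient.eq_zero_iff_mem]
    exact Ideal.mem_span_singleton_self _
  have hne (a : F) : a ^ t ≠ 1 ↔ a ^ t + 1 ≠ 0 := by rw [Ne, Ne, CharTwo.add_eq_zero]
  have hterm : ∀ a ∈ Finset.univ.filter (fun a : F ↦ a ^ t ≠ 1),
      Ring.inverse (Ideal.Quotient.mk I (X - C a)) =
        -∑ i ∈ Finset.range t, (Ideal.Quotient.mk I X) ^ i *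
          algebraMap F (F[X] ⧸ I) (a ^ (t - 1 - i) * (a ^ t + 1)⁻¹) := fun a ha ↦ by
    rw [← inverse_sub_algebraMap_of_pow_eq_neg_one hx ((hne a).1 (Finset.mem_filter.1 ha).2)]
    rfl
  rw [Finset.sum_congr rfl hterm, Finset.sum_neg_distrib, Finset.sum_comm, neg_eq_zero]
  refine Finset.sum_eq_zero fun i hi ↦ ?_
  rw [← Finset.mul_sum, ← map_sum, Finset.sum_filter_of_ne, hsum _ (by lia), map_zero, mul_zero]
  intro a _ h
  rw [hne]
  exact fun h0 ↦ h (by simp [h0])
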